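/- The number of 2-abelian equivalence classes of binary words of length n is Θ(n²); more precisely, it is bounded above by C·n² for some constant C and below by c·n² for some c > 0, for all sufficiently large n. -/

import Mathlib

/-- Number of occurrences of `w` as a factor (contiguous subword) of `u`. -/
def countOcc {α : Type*} [DecidableEq α] (w u : List α) : ℕ :=
  u.tails.countP (fun t => w.isPrefixOf t)

/-- `k`-abelian equivalence: same prefix and suffix of length `k-1`
(truncated to the words' lengths) and same number of occurrences of
every factor of length `k`. -/
def KAbEq {α : Type*} [DecidableEq α] (k : ℕ) (u v : List α) : Prop :=
  u.take (k - 1) = v.take (k - 1) ∧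
  u.drop (u.length - (k - 1)) = v.drop (v.length - (k - 1)) ∧
  ∀ w : List α, w.length = k → countOcc w u = countOcc w v

/-- Number of 2-abelian equivalence classes of binary words of length n. -/
noncomputable def numClasses2 (n : ℕ) : ℕ :=
  Nat.card (Quot (fun u v : {w : List (Fin 2) // w.length = n} => KAbEq 2 u.1 v.1))

/-- The number of occurrences of `w` in `x :: u` counts the one at the start separately. -/
theorem countOcc_cons {α : Type*} [DecidableEq α] (w : List α) (x : α) (u : List α) :
    countOcc w (x :: u) = countOcc w u + if w.isPrefixOf (x :: u) then 1 else 0 := by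
  simp [countOcc, List.countP_cons]

theorem countOcc_pair_nil {α : Type*} [DecidableEq α] (p q : α) : countOcc [p, q] [] = 0 := by
  simp [countOcc]

theorem countOcc_pair_singleton {α : Type*} [DecidableEq α] (p q x : α) :
    countOcc [p, q] [x] = 0 := by
  simp [countOcc_cons, countOcc_pair_nil]

theorem countOcc_pair_cons_cons {α : Type*} [DecidableEq α] (p q x y : α) (u : List α) :
    countOcc [p, q] (x :: y :: u) =
      countOcc [p, q] (y :: u) + if p = x ∧ q = y then 1 else 0 := by
  rw [countOcc_cons]
  simp [List.isPrefixOf]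

/-- Each position of a nonempty binary word except the last starts exactly one factor of
length two. -/
theorem sum_countOcc_pair (x : Fin 2) (u : List (Fin 2)) :
    countOcc [0, 0] (x :: u) + countOcc [0, 1] (x :: u) + countOcc [1, 0] (x :: u) +
      countOcc [1, 1] (x :: u) = u.length := by
  induction u generalizing x with
  | nil => simp [countOcc_pair_singleton]
  | cons y u ih =>
    have := ih y
    simp only [countOcc_pair_cons_cons, List.length_cons]
    fin_cases x <;> fin_cases y <;> simp at this ⊢ <;> omega

/-- The numbers of ascents and descents of a binary word differ by the difference between its
last and first letters. -/
theorem countOcc_ascent_add_head (x : Fin 2) (u : List (Fin 2)) :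
    countOcc [0, 1] (x :: u) + x.val =
      countOcc [1, 0] (x :: u) + ((x :: u).getLast (List.cons_ne_nil x u)).val := by
  induction u generalizing x with
  | nil => simp [countOcc_pair_singleton]
  | cons y u ih =>
    have := ih y
    rw [List.getLast_cons (List.cons_ne_nil y u)]
    simp only [countOcc_pair_cons_cons]
    fin_cases x <;> fin_cases y <;> simp at this ⊢ <;> omega

/-- Nonempty binary words of the same length are 2-abelian equivalent as soon as they agree in
their first letters, their last letters and their numbers of factors `00` and `01`. -/
theorem kAbEq_two_of_eq (x y : Fin 2) (u v : List (Fin 2)) (hlen : u.length = v.length)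
    (hhead : x = y)
    (hlast : (x :: u).getLast (List.cons_ne_nil x u) = (y :: v).getLast (List.cons_ne_nil y v))
    (h00 : countOcc [0, 0] (x :: u) = countOcc [0, 0] (y :: v))
    (h01 : countOcc [0, 1] (x :: u) = countOcc [0, 1] (y :: v)) :
    KAbEq 2 (x :: u) (y :: v) := by
  have hu := sum_countOcc_pair x u
  have hv := sum_countOcc_pair y v
  have au := countOcc_ascent_add_head x u
  have av := countOcc_ascent_add_head y v
  rw [hlast, hhead] at au
  rw [hhead] at h00 h01 hu
  subst hhead
  refine ⟨by simp, ?_, ?_⟩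
  · rw [show 2 - 1 = 1 from rfl, List.drop_length_sub_one (List.cons_ne_nil x u),
      List.drop_length_sub_one (List.cons_ne_nil x v), hlast]
  · intro w hw
    obtain ⟨p, q, rfl⟩ := List.length_eq_two.mp hw
    fin_cases p <;> fin_cases q <;> simp <;> omega

theorem countOcc_pair_le_length (p q : Fin 2) (x : Fin 2) (u : List (Fin 2)) :
    countOcc [p, q] (x :: u) ≤ u.length := by
  have := sum_countOcc_pair x u
  fin_cases p <;> fin_cases q <;> simp <;> omega

/-- There is a map from the 2-abelian classes to the quadruples (first letter, last letter,
number of `00`, number of `01`), and it is injective. -/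
theorem exists_injective_quot_kAbEq (n : ℕ) :
    ∃ f : Quot (fun u v : {w : List (Fin 2) // w.length = n + 1} => KAbEq 2 u.1 v.1) →
      Fin 2 × Fin 2 × Fin (n + 1) × Fin (n + 1), Function.Injective f := by
  have key : ∀ w : {w : List (Fin 2) // w.length = n + 1}, ∃ x u, w.1 = x :: u ∧ u.length = n := by
    rintro ⟨_ | ⟨x, u⟩, hw⟩
    · simp at hw
    · exact ⟨x, u, rfl, by simpa using hw⟩
  choose x u hxu hu using key
  refine ⟨fun q => (x q.out, (x q.out :: u q.out).getLast (List.cons_ne_nil _ _),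
    ⟨countOcc [0, 0] (x q.out :: u q.out), ?_⟩,
    ⟨countOcc [0, 1] (x q.out :: u q.out), ?_⟩), ?_⟩
  · exact Nat.lt_succ_of_le ((countOcc_pair_le_length _ _ _ _).trans (hu _).le)
  · exact Nat.lt_succ_of_le ((countOcc_pair_le_length _ _ _ _).trans (hu _).le)
  · intro p q h
    simp only [Prod.mk.injEq, Fin.mk.injEq] at h
    obtain ⟨h1, h2, h3, h4⟩ := h
    rw [← Quot.out_eq p, ← Quot.out_eq q]
    apply Quot.sound
    rw [hxu, hxu]
    exact kAbEq_two_of_eq _ _ _ _ ((hu _).trans (hu _).symm) h1 h2 h3 h4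

/-- The word `0 ^ (i + 1) (1 0) ^ j 1 ^ (r + 1)`. -/
def runWord (i j r : ℕ) : List (Fin 2) :=
  (List.cons 0)^[i + 1] ((fun u => 1 :: 0 :: u)^[j] (List.replicate (r + 1) 1))

theorem runWord_zero_zero (r : ℕ) : runWord 0 0 r = 0 :: 1 :: List.replicate r 1 := by
  simp [runWord, List.replicate_succ]

theorem runWord_zero_succ (j r : ℕ) : runWord 0 (j + 1) r = 0 :: 1 :: runWord 0 j r := by
  simp [runWord, Function.iterate_succ_apply']

theorem runWord_succ (i j r : ℕ) : runWord (i + 1) j r = 0 :: runWord i j r :=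
  Function.iterate_succ_apply' _ _ _

theorem length_runWord (i j r : ℕ) : (runWord i j r).length = i + 2 * j + r + 2 := by
  induction i with
  | zero =>
    induction j with
    | zero => simp [runWord_zero_zero]
    | succ j ih => simp [runWord_zero_succ, ih]; ring
  | succ i ih => simp [runWord_succ, ih]; ring

theorem exists_runWord_eq_cons (i j r : ℕ) : ∃ u, runWord i j r = 0 :: u :=
  ⟨_, Function.iterate_succ_apply' _ _ _⟩

theorem countOcc_replicate_one (p q : Fin 2) (h : p = 0 ∨ q = 0) (r : ℕ) :
    countOcc [p, q] (List.replicate r 1) = 0 := by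
  induction r with
  | zero => exact countOcc_pair_nil p q
  | succ r ih =>
    cases r with
    | zero => exact countOcc_pair_singleton p q 1
    | succ r =>
      simp only [List.replicate_succ] at ih ⊢
      rw [countOcc_pair_cons_cons, ih]
      rcases h with rfl | rfl <;> simp

theorem countOcc_runWord (i j r : ℕ) :
    countOcc [0, 0] (runWord i j r) = i ∧ countOcc [1, 0] (runWord i j r) = j := by
  induction i with
  | zero =>
    induction j with
    | zero =>
      rw [runWord_zero_zero]
      have h0 := countOcc_replicate_one 0 0 (by simp) (r + 1)
      have h1 := countOcc_replicate_one 1 0 (by simp) (r + 1)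
      rw [List.replicate_succ] at h0 h1
      simp [countOcc_pair_cons_cons, h0, h1]
    | succ j ih =>
      rw [runWord_zero_succ]
      obtain ⟨u, hu⟩ := exists_runWord_eq_cons 0 j r
      rw [hu] at ih ⊢
      simp [countOcc_pair_cons_cons, ih.1, ih.2]
  | succ i ih =>
    rw [runWord_succ]
    obtain ⟨u, hu⟩ := exists_runWord_eq_cons i j r
    rw [hu] at ih ⊢
    simp [countOcc_pair_cons_cons, ih.1, ih.2]

theorem numClasses2_le (n : ℕ) : numClasses2 (n + 1) ≤ 4 * (n + 1) ^ 2 := by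
  obtain ⟨f, hf⟩ := exists_injective_quot_kAbEq n
  have := Nat.card_le_card_of_injective f hf
  simp only [Nat.card_eq_fintype_card, Fintype.card_prod, Fintype.card_fin] at this
  unfold numClasses2
  linarith

theorem sq_le_numClasses2 (n k : ℕ) (hk : 3 * k ≤ n + 1) : k ^ 2 ≤ numClasses2 (n + 1) := by
  obtain ⟨f, hf⟩ := exists_injective_quot_kAbEq n
  have := Finite.of_injective f hf
  let g : Fin k × Fin k →
      Quot (fun u v : {w : List (Fin 2) // w.length = n + 1} => KAbEq 2 u.1 v.1) :=
    fun p => Quot.mk _ ⟨runWord p.1 p.2 (n + 1 - (p.1 + 2 * p.2 + 2)), by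
      rw [length_runWord]; omega⟩
  let c (p q : Fin 2) :
      Quot (fun u v : {w : List (Fin 2) // w.length = n + 1} => KAbEq 2 u.1 v.1) → ℕ :=
    Quot.lift (fun u => countOcc [p, q] u.1) fun u v h => h.2.2 [p, q] rfl
  have hg : Function.Injective g := by
    intro p q h
    have h0 : countOcc _ _ = countOcc _ _ := congrArg (c 0 0) h
    have h1 : countOcc _ _ = countOcc _ _ := congrArg (c 1 0) h
    rw [(countOcc_runWord _ _ _).1, (countOcc_runWord _ _ _).1] at h0
    rw [(countOcc_runWord _ _ _).2, (countOcc_runWord _ _ _).2] at h1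
    exact Prod.ext (Fin.ext h0) (Fin.ext h1)
  have := Nat.card_le_card_of_injective g hg
  simp only [Nat.card_eq_fintype_card, Fintype.card_prod, Fintype.card_fin] at this
  rw [sq]
  exact this

/-- the number of 2-abelian classes of binary words of length n is Θ(n²). -/
theorem numClasses2_theta_n_sq :
    ∃ C c : ℝ, 0 < c ∧ ∃ N : ℕ, ∀ n : ℕ, N ≤ n →
      (numClasses2 n : ℝ) ≤ C * (n : ℝ) ^ 2 ∧ c * (n : ℝ) ^ 2 ≤ (numClasses2 n : ℝ) := by
  refine ⟨4, 1 / 36, by norm_num, 3, fun n hn => ?_⟩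
  obtain ⟨m, rfl⟩ : ∃ m, n = m + 1 := ⟨n - 1, by omega⟩
  refine ⟨by exact_mod_cast numClasses2_le m, ?_⟩
  have hk : m + 1 ≤ 6 * ((m + 1) / 3) := by omega
  have hlow : (m + 1) ^ 2 ≤ 36 * numClasses2 (m + 1) := by
    have := sq_le_numClasses2 m ((m + 1) / 3) (by omega)
    have := Nat.pow_le_pow_left hk 2
    linarith
  have : ((m + 1 : ℕ) : ℝ) ^ 2 ≤ 36 * (numClasses2 (m + 1) : ℝ) := by exact_mod_cast hlow
  linarith
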